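/- Let n ≥ 1 and K > 0. For each i ∈ Fin n let g_i : (Fin n → ℝ) → ℝ be continuous on [0,K]^n and monotone nondecreasing in its i-th coordinate (i.e., for each fixed a, the map x ↦ g_i(update a i x) is nondecreasing on [0,K]), and fix y_i ∈ ℝ such that for every a ∈ [0,K]^n, g_i(update a i 0) ≤ y_i and g_i(update a i K) ≥ y_i. Then there exists a profile a* ∈ [0,K]^n such that g_i(a*) = y_i for every i ∈ Fin n. -/

import Mathlib

section CubicalCup

variable {ι : Type*} [DecidableEq ι]

/-- The mod 2 cubical cup product of the coboundaries of the labels `L i`, `i ∈ l`, evaluated on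
the unit cube based at `x` and spanned by the directions in `K`. -/
def cupForm (L : ι → (ι → ℕ) → ZMod 2) : List ι → Finset ι → (ι → ℕ) → ZMod 2
  | [], K, _ => if K = ∅ then 1 else 0
  | i :: l, K, x => ∑ j ∈ K, (L i (x + Pi.single j 1) + L i x) *
      cupForm L l (K.erase j) (x + Pi.single j 1)

/-- Iterated sum of `f` over the values `0, …, p - 1` of the coordinates in `l`, the other
coordinates being those of `c`. -/
def gridSum (p : ℕ) : List ι → ((ι → ℕ) → ZMod 2) → (ι → ℕ) → ZMod 2
  | [], f, c => f c
  | j :: l, f, c => ∑ t ∈ Finset.range p, gridSum p l f (Function.update c j t)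

theorem sum_sum_erase_eq_zero_of_symm (K : Finset ι) (f : ι → ι → ZMod 2)
    (hf : ∀ i j, f i j = f j i) : ∑ j ∈ K, ∑ i ∈ K.erase j, f j i = 0 := by
  rw [Finset.sum_sigma']
  refine Finset.sum_involution (fun a _ => ⟨a.2, a.1⟩) ?_ ?_ ?_ ?_
  · rintro ⟨i, j⟩ _
    simp only [hf i j]
    exact CharTwo.add_self_eq_zero _
  · rintro ⟨i, j⟩ h _ heq
    simp only [Finset.mem_sigma, Finset.mem_erase] at h
    simp only [Sigma.mk.injEq] at heq
    exact h.2.1 heq.1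
  · rintro ⟨i, j⟩ h
    simp only [Finset.mem_sigma, Finset.mem_erase] at h ⊢
    exact ⟨h.2.2, Ne.symm h.2.1, h.1⟩
  · rintro ⟨i, j⟩ _
    rfl

theorem sum_sum_erase_comm (K : Finset ι) (f : ι → ι → ZMod 2) :
    ∑ j ∈ K, ∑ i ∈ K.erase j, f j i = ∑ j ∈ K, ∑ i ∈ K.erase j, f i j := by
  refine Finset.sum_comm' fun i j => ?_
  simp only [Finset.mem_erase]
  tauto

theorem cupForm_closed (L : ι → (ι → ℕ) → ZMod 2) (l : List ι) :
    ∀ (K : Finset ι) (x : ι → ℕ),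
      ∑ j ∈ K, (cupForm L l (K.erase j) (x + Pi.single j 1) + cupForm L l (K.erase j) x) = 0 := by
  induction l with
  | nil =>
    intro K x
    exact Finset.sum_eq_zero fun j _ => CharTwo.add_self_eq_zero _
  | cons k l ih =>
    intro K x
    set D : ι → ι → (ι → ℕ) → ZMod 2 := fun j i => cupForm L l ((K.erase j).erase i) with hD
    have hDs (i j : ι) : D i j = D j i := by simp only [hD, Finset.erase_right_comm]
    have h₁ : ∑ j ∈ K, ∑ i ∈ K.erase j, L k (x + Pi.single j 1 + Pi.single i 1) *
        D j i (x + Pi.single j 1 + Pi.single i 1) = 0 :=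
      sum_sum_erase_eq_zero_of_symm K _ fun i j => by
        rw [hDs, add_right_comm]
    have h₂ : ∑ j ∈ K, ∑ i ∈ K.erase j, L k (x + Pi.single i 1) * D j i (x + Pi.single i 1) =
        ∑ j ∈ K, ∑ i ∈ K.erase j, L k (x + Pi.single j 1) * D j i (x + Pi.single j 1) := by
      rw [sum_sum_erase_comm]
      exact Finset.sum_congr rfl fun j _ => Finset.sum_congr rfl fun i _ => by rw [hDs]
    have h₃ : ∑ j ∈ K, ∑ i ∈ K.erase j, (L k (x + Pi.single j 1) *
        D j i (x + Pi.single j 1 + Pi.single i 1) +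
        L k (x + Pi.single j 1) * D j i (x + Pi.single j 1)) = 0 :=
      Finset.sum_eq_zero fun j _ => by
        simp only [← mul_add]
        rw [← Finset.mul_sum, ih, mul_zero]
    have h₄ : ∑ j ∈ K, ∑ i ∈ K.erase j, (D j i (x + Pi.single i 1) + D j i x) = 0 :=
      Finset.sum_eq_zero fun j _ => ih (K.erase j) x
    have h₅ : ∑ j ∈ K, ∑ i ∈ K.erase j, D j i x = 0 :=
      sum_sum_erase_eq_zero_of_symm K _ fun i j => by rw [hDs]
    have h₆ : ∑ j ∈ K, ∑ i ∈ K.erase j, L k x * D j i (x + Pi.single i 1) = 0 := by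
      simp only [← Finset.mul_sum]
      simp only [Finset.sum_add_distrib] at h₄
      rw [h₅, add_zero] at h₄
      rw [h₄, mul_zero]
    simp only [cupForm, add_mul, Finset.sum_add_distrib]
    simp only [Finset.sum_add_distrib] at h₃
    linear_combination h₁ + h₂ + h₃ + h₆

theorem cupForm_cons_eq (L : ι → (ι → ℕ) → ZMod 2) (k : ι) (l : List ι) (K : Finset ι)
    (x : ι → ℕ) :
    cupForm L (k :: l) K x = ∑ j ∈ K,
      (L k (x + Pi.single j 1) * cupForm L l (K.erase j) (x + Pi.single j 1) +
        L k x * cupForm L l (K.erase j) x) := by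
  have h := congrArg (L k x * ·) (cupForm_closed L l K x)
  simp only [mul_zero, Finset.mul_sum] at h
  rw [cupForm, ← sub_eq_zero, ← Finset.sum_sub_distrib, ← h]
  refine Finset.sum_congr rfl fun j _ => ?_
  have h2 : (2 : ZMod 2) = 0 := rfl
  linear_combination (-L k x * cupForm L l (K.erase j) x) * h2

theorem cupForm_eq_zero_of_notMem {L : ι → (ι → ℕ) → ZMod 2} {p : ℕ}
    (h0 : ∀ i x, x i = 0 → L i x = 0) (hp : ∀ i x, x i = p → L i x = 1) {j : ι} :
    ∀ (l : List ι) (K : Finset ι) (x : ι → ℕ), j ∉ K → j ∈ l → x j = 0 ∨ x j = p →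
      cupForm L l K x = 0 := by
  intro l
  induction l with
  | nil => simp
  | cons k l ih =>
    intro K x hK hl hx
    refine Finset.sum_eq_zero fun i hi => ?_
    have hij : j ≠ i := fun h => hK (h ▸ hi)
    have hxi : (x + Pi.single i 1 : ι → ℕ) j = x j := by simp [hij]
    rcases List.mem_cons.1 hl with rfl | hl
    · rcases hx with hx | hx
      · rw [h0 _ _ hx, h0 _ _ (hxi.trans hx)]; simp
      · rw [hp _ _ hx, hp _ _ (hxi.trans hx), CharTwo.add_self_eq_zero, zero_mul]
    · rw [ih _ _ (fun h => hK (Finset.mem_of_mem_erase h)) hl (by rwa [hxi]), mul_zero]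

theorem exists_ne_of_cupForm_ne_zero {L : ι → (ι → ℕ) → ZMod 2} :
    ∀ (l : List ι) (K : Finset ι) (x : ι → ℕ), cupForm L l K x ≠ 0 → ∀ i ∈ l,
      ∃ v w : ι → ℕ, (∀ k, x k ≤ v k ∧ v k ≤ x k + if k ∈ K then 1 else 0) ∧
        (∀ k, x k ≤ w k ∧ w k ≤ x k + if k ∈ K then 1 else 0) ∧ L i v ≠ L i w := by
  intro l
  induction l with
  | nil => simp
  | cons k l ih =>
    intro K x h i hi
    obtain ⟨j, hj, hne⟩ := Finset.exists_ne_zero_of_sum_ne_zero h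
    have hstep (m : ι) : (x + Pi.single j 1 : ι → ℕ) m = x m + if m = j then 1 else 0 := by
      simp [Pi.single_apply]
    rcases List.mem_cons.1 hi with rfl | hi
    · refine ⟨x + Pi.single j 1, x, fun m => ?_, fun m => by simp, fun heq => ?_⟩
      · rw [hstep]
        by_cases hm : m = j
        · subst hm; simp [hj]
        · simp [hm]
      · rw [heq, CharTwo.add_self_eq_zero, zero_mul] at hne
        exact hne rfl
    · obtain ⟨v, w, hv, hw, hvw⟩ := ih _ _ (right_ne_zero_of_mul hne) i hi
      have aux (u : ι → ℕ) (hu : ∀ m, (x + Pi.single j 1 : ι → ℕ) m ≤ u m ∧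
          u m ≤ (x + Pi.single j 1 : ι → ℕ) m + if m ∈ K.erase j then 1 else 0) (m : ι) :
          x m ≤ u m ∧ u m ≤ x m + if m ∈ K then 1 else 0 := by
        have := hu m
        rw [hstep] at this
        by_cases hm : m = j
        · subst hm
          simp only [hj, if_true, Finset.notMem_erase, if_false] at this ⊢
          omega
        · simpa [hm] using this
      exact ⟨v, w, aux v hv, aux w hw, hvw⟩

theorem gridSum_sum {κ : Type*} (p : ℕ) (K : Finset κ) (f : κ → (ι → ℕ) → ZMod 2) (l : List ι) :
    ∀ c, gridSum p l (fun x => ∑ j ∈ K, f j x) c = ∑ j ∈ K, gridSum p l (f j) c := by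
  induction l with
  | nil => intro c; rfl
  | cons k l ih =>
    intro c
    simp only [gridSum, ih]
    exact Finset.sum_comm

theorem gridSum_zero (p : ℕ) (l : List ι) : ∀ c : ι → ℕ, gridSum p l (fun _ => 0) c = 0 := by
  induction l with
  | nil => intro c; rfl
  | cons k l ih => intro c; simp [gridSum, ih]

theorem gridSum_update (p : ℕ) {j : ι} (t : ℕ) (f : (ι → ℕ) → ZMod 2) (l : List ι) (hj : j ∉ l) :
    ∀ c, gridSum p l (fun x => f (Function.update x j t)) c =
      gridSum p l f (Function.update c j t) := by
  induction l with
  | nil => intro c; rfl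
  | cons k l ih =>
    intro c
    rw [List.mem_cons, not_or] at hj
    simp only [gridSum, ih hj.2]
    exact Finset.sum_congr rfl fun s _ => by rw [Function.update_comm hj.1]

theorem gridSum_eq_erase (p : ℕ) {j : ι} (f : (ι → ℕ) → ZMod 2) (l : List ι) (hl : l.Nodup)
    (hj : j ∈ l) :
    ∀ c, gridSum p l f c =
      gridSum p (l.erase j) (fun x => ∑ t ∈ Finset.range p, f (Function.update x j t)) c := by
  induction l with
  | nil => simp at hj
  | cons k l ih =>
    intro c
    rw [List.nodup_cons] at hl
    by_cases hkj : k = j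
    · subst hkj
      rw [List.erase_cons_head, gridSum_sum, gridSum]
      exact Finset.sum_congr rfl fun t _ => (gridSum_update p t f l hl.1 c).symm
    · have hjl : j ∈ l := (List.mem_cons.1 hj).resolve_left (Ne.symm hkj)
      rw [List.erase_cons_tail (by simpa using hkj)]
      exact Finset.sum_congr rfl fun t _ => ih hl.2 hjl _

theorem exists_ne_zero_of_gridSum_ne_zero (p : ℕ) (f : (ι → ℕ) → ZMod 2) (l : List ι) :
    ∀ c, gridSum p l f c ≠ 0 → ∃ x, (∀ i, (i ∈ l → x i < p) ∧ (i ∉ l → x i = c i)) ∧ f x ≠ 0 := by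
  induction l with
  | nil => exact fun c h => ⟨c, by simp, h⟩
  | cons k l ih =>
    intro c h
    obtain ⟨t, ht, hne⟩ := Finset.exists_ne_zero_of_sum_ne_zero h
    obtain ⟨x, hx, hfx⟩ := ih _ hne
    refine ⟨x, fun i => ⟨fun hi => ?_, fun hi => ?_⟩, hfx⟩
    · by_cases hil : i ∈ l
      · exact (hx i).1 hil
      · obtain rfl : i = k := (List.mem_cons.1 hi).resolve_right hil
        rw [(hx i).2 hil, Function.update_self]
        exact Finset.mem_range.1 ht
    · rw [List.mem_cons, not_or] at hi
      rw [(hx i).2 hi.2, Function.update_of_ne hi.1]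

theorem sum_range_shift_add (p : ℕ) (j : ι) (F : (ι → ℕ) → ZMod 2) (x : ι → ℕ) :
    ∑ t ∈ Finset.range p,
        (F (Function.update x j t + Pi.single j 1) + F (Function.update x j t)) =
      F (Function.update x j p) + F (Function.update x j 0) := by
  have h (t : ℕ) : Function.update x j t + Pi.single j 1 = Function.update x j (t + 1) := by
    ext m
    by_cases hm : m = j
    · subst hm; simp
    · simp [hm]
  simp only [h, ← CharTwo.sub_eq_add]
  exact Finset.sum_range_sub (fun t => F (Function.update x j t)) p

theorem gridSum_cupForm {L : ι → (ι → ℕ) → ZMod 2} {p : ℕ}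
    (h0 : ∀ i x, x i = 0 → L i x = 0) (hp : ∀ i x, x i = p → L i x = 1) (l : List ι)
    (hl : l.Nodup) : ∀ c, gridSum p l (cupForm L l l.toFinset) c = 1 := by
  induction l with
  | nil => intro c; simp [gridSum, cupForm]
  | cons k l ih =>
    intro c
    have hkl := (List.nodup_cons.1 hl).1
    set K := (k :: l).toFinset with hK
    have hterm (j : ι) (hj : j ∈ K) : gridSum p (k :: l) (fun x =>
        L k (x + Pi.single j 1) * cupForm L l (K.erase j) (x + Pi.single j 1) +
          L k x * cupForm L l (K.erase j) x) c = if j = k then 1 else 0 := by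
      rw [gridSum_eq_erase p _ _ hl (List.mem_toFinset.1 hj)]
      simp only [sum_range_shift_add p j (fun x => L k x * cupForm L l (K.erase j) x)]
      split_ifs with hjk
      · subst hjk
        have hKl : K.erase j = l.toFinset := by
          rw [hK, List.toFinset_cons, Finset.erase_insert (by simpa using hkl)]
        rw [List.erase_cons_head, hKl]
        simp only [h0 j (Function.update _ j 0) (Function.update_self ..),
          hp j (Function.update _ j p) (Function.update_self ..), one_mul, zero_mul, add_zero]
        rw [gridSum_update p p _ l hkl, ih (List.nodup_cons.1 hl).2]
      · have hjl : j ∈ l := (List.mem_cons.1 (List.mem_toFinset.1 hj)).resolve_left hjk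
        have hz (t : ℕ) (ht : t = 0 ∨ t = p) (x : ι → ℕ) :
            cupForm L l (K.erase j) (Function.update x j t) = 0 :=
          cupForm_eq_zero_of_notMem h0 hp l _ _ (Finset.notMem_erase j K) hjl (by simpa using ht)
        simp only [hz 0 (Or.inl rfl), hz p (Or.inr rfl), mul_zero, add_zero]
        exact gridSum_zero p _ c
    rw [funext (cupForm_cons_eq L k l K), gridSum_sum, Finset.sum_congr rfl hterm]
    simp [hK]

/-- A cubical Sperner lemma: if every label `L i` is `0` on the face `x i = 0` and `1` on the face
`x i = p` of the grid `{0, …, p}^ι`, then some unit cube of the grid has, for every `i`, vertices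
labelled `0` and `1` by `L i`. -/
theorem exists_cube_with_all_labels [Fintype ι] {L : ι → (ι → ℕ) → ZMod 2} {p : ℕ}
    (h0 : ∀ i x, x i = 0 → L i x = 0) (hp : ∀ i x, x i = p → L i x = 1) :
    ∃ x : ι → ℕ, (∀ i, x i < p) ∧ ∀ i, ∃ v w : ι → ℕ, (∀ k, x k ≤ v k ∧ v k ≤ x k + 1) ∧
      (∀ k, x k ≤ w k ∧ w k ≤ x k + 1) ∧ L i v = 0 ∧ L i w = 1 := by
  have hmem (i : ι) : i ∈ (Finset.univ : Finset ι).toList := by simp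
  have h := gridSum_cupForm h0 hp _ (Finset.nodup_toList (Finset.univ : Finset ι)) 0
  obtain ⟨x, hx, hne⟩ := exists_ne_zero_of_gridSum_ne_zero p _ _ 0 (h ▸ one_ne_zero)
  refine ⟨x, fun i => (hx i).1 (hmem i), fun i => ?_⟩
  obtain ⟨v, w, hv, hw, hvw⟩ := exists_ne_of_cupForm_ne_zero _ _ _ hne i (hmem i)
  simp only [Finset.toList_toFinset, Finset.mem_univ, if_true] at hv hw
  have h01 : ∀ a b : ZMod 2, a ≠ b → a = 0 ∧ b = 1 ∨ b = 0 ∧ a = 1 := by decide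
  rcases h01 _ _ hvw with ⟨ha, hb⟩ | ⟨ha, hb⟩
  · exact ⟨v, w, hv, hw, ha, hb⟩
  · exact ⟨w, v, hw, hv, ha, hb⟩

end CubicalCup

/-- The **Poincaré–Miranda theorem** on the cube `[0, K]^ι`. -/
theorem poincare_miranda {ι : Type*} [Fintype ι] {K : ℝ} (hK : 0 < K)
    {g : ι → (ι → ℝ) → ℝ} {y : ι → ℝ}
    (hcont : ∀ i, ContinuousOn (g i) (Set.Icc 0 fun _ => K))
    (hlow : ∀ i, ∀ a ∈ Set.Icc (0 : ι → ℝ) fun _ => K, a i = 0 → g i a ≤ y i)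
    (hhigh : ∀ i, ∀ a ∈ Set.Icc (0 : ι → ℝ) fun _ => K, a i = K → y i ≤ g i a) :
    ∃ a ∈ Set.Icc (0 : ι → ℝ) fun _ => K, ∀ i, g i a = y i := by
  classical
  let pt (m : ℕ) (x : ι → ℕ) : ι → ℝ := fun i => K * (x i / (m + 1))
  have hpt (m : ℕ) (x : ι → ℕ) (hx : ∀ i, x i ≤ m + 1) : pt m x ∈ Set.Icc 0 fun _ => K := by
    refine ⟨fun i => by simp only [pt, Pi.zero_apply]; positivity, fun i => ?_⟩
    refine mul_le_of_le_one_right hK.le ((div_le_one (by positivity)).2 ?_)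
    have h : (x i : ℝ) ≤ (m + 1 : ℕ) := Nat.cast_le.2 (hx i)
    simpa using h
  have key (m : ℕ) : ∃ x : ι → ℕ, (∀ i, x i < m + 1) ∧ ∀ i, ∃ v w : ι → ℕ,
      (∀ k, x k ≤ v k ∧ v k ≤ x k + 1) ∧ (∀ k, x k ≤ w k ∧ w k ≤ x k + 1) ∧
      g i (pt m v) ≤ y i ∧ y i ≤ g i (pt m w) := by
    let L (i : ι) (x : ι → ℕ) : ZMod 2 :=
      if x i ≠ 0 ∧ (x i = m + 1 ∨ y i < g i (pt m x)) then 1 else 0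
    obtain ⟨x, hx, h⟩ := exists_cube_with_all_labels (L := L) (p := m + 1)
      (fun i x hi => by simp [L, hi]) (fun i x hi => by simp [L, hi])
    refine ⟨x, hx, fun i => ?_⟩
    obtain ⟨v, w, hv, hw, hLv, hLw⟩ := h i
    have hvm := hpt m v fun k => (hv k).2.trans (hx k)
    have hwm := hpt m w fun k => (hw k).2.trans (hx k)
    refine ⟨v, w, hv, hw, ?_, ?_⟩
    · by_contra! hlt
      by_cases hv0 : v i = 0
      · exact hlt.not_ge (hlow i _ hvm (by simp [pt, hv0]))
      · simp [L, hv0, hlt] at hLv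
    · by_contra! hlt
      by_cases hwp : w i = m + 1
      · refine hlt.not_ge (hhigh i _ hwm ?_)
        have : (m : ℝ) + 1 ≠ 0 := by positivity
        simp [pt, hwp, this]
      · simp [L, hwp, hlt.not_gt] at hLw
  choose x hx v w hv hw hgv hgw using key
  obtain ⟨a, ha, φ, hφ, hlim⟩ := (isCompact_Icc (a := (0 : ι → ℝ)) (b := fun _ => K)).tendsto_subseq
    fun m => hpt m (x m) fun i => (hx m i).le
  have hnear (u : ℕ → ι → ℕ) (hu : ∀ m k, x m k ≤ u m k ∧ u m k ≤ x m k + 1) :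
      Filter.Tendsto (fun m => pt (φ m) (u (φ m))) Filter.atTop
        (nhdsWithin a (Set.Icc 0 fun _ => K)) := by
    refine tendsto_nhdsWithin_iff.2 ⟨tendsto_pi_nhds.2 fun k => ?_,
      Filter.Eventually.of_forall fun m => hpt _ _ fun k => (hu _ k).2.trans (hx _ k)⟩
    have hl := tendsto_pi_nhds.1 hlim k
    have he : Filter.Tendsto (fun m => K * (1 / ((φ m : ℝ) + 1))) Filter.atTop (nhds 0) := by
      simpa using (tendsto_one_div_add_atTop_nhds_zero_nat.comp hφ.tendsto_atTop).const_mul K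
    refine tendsto_of_tendsto_of_tendsto_of_le_of_le hl (by simpa only [add_zero] using hl.add he)
      (fun m => ?_) (fun m => ?_)
    · simp only [pt, Function.comp_apply]
      gcongr
      exact (hu _ k).1
    · simp only [pt, Function.comp_apply]
      rw [← mul_add, ← add_div]
      gcongr
      exact_mod_cast (hu _ k).2
  refine ⟨a, ha, fun i => le_antisymm ?_ ?_⟩
  · exact le_of_tendsto ((hcont i a ha).tendsto.comp (hnear (fun m => v m i) fun m => hv m i))
      (Filter.Eventually.of_forall fun m => hgv (φ m) i)
  · exact ge_of_tendsto ((hcont i a ha).tendsto.comp (hnear (fun m => w m i) fun m => hw m i))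
      (Filter.Eventually.of_forall fun m => hgw (φ m) i)

/-- Fixed-point content of Theorem 1: if each `g i` is continuous on the cube `[0,K]^n`,
monotone nondecreasing in its `i`-th coordinate, and satisfies
`g i (update a i 0) ≤ y i ≤ g i (update a i K)` for all profiles `a` in the cube,
then there is a profile `a*` in the cube with `g i a* = y i` for all `i`. -/
theorem stmt_5 (n : ℕ) (hn : 1 ≤ n) (K : ℝ) (hK : 0 < K)
    (g : Fin n → (Fin n → ℝ) → ℝ) (y : Fin n → ℝ)
    (hcont : ∀ i, ContinuousOn (g i) (Set.Icc (0 : Fin n → ℝ) (fun _ => K)))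
    (hmono : ∀ i (a : Fin n → ℝ), a ∈ Set.Icc (0 : Fin n → ℝ) (fun _ => K) →
      ∀ x₁ x₂ : ℝ, 0 ≤ x₁ → x₁ ≤ x₂ → x₂ ≤ K →
        g i (Function.update a i x₁) ≤ g i (Function.update a i x₂))
    (hlow : ∀ i (a : Fin n → ℝ), a ∈ Set.Icc (0 : Fin n → ℝ) (fun _ => K) →
      g i (Function.update a i 0) ≤ y i)
    (hhigh : ∀ i (a : Fin n → ℝ), a ∈ Set.Icc (0 : Fin n → ℝ) (fun _ => K) →
      y i ≤ g i (Function.update a i K)) :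
    ∃ a : Fin n → ℝ, a ∈ Set.Icc (0 : Fin n → ℝ) (fun _ => K) ∧ ∀ i, g i a = y i := by
  refine poincare_miranda hK hcont (fun i a ha hi => ?_) (fun i a ha hi => ?_)
  · simpa [← hi] using hlow i a ha
  · simpa [← hi] using hhigh i a ha
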